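/- arXiv:2407.06213 — 2 statements merged into one kernel-verified Lean document; each statement's English description precedes it below -/
import Mathlib

section
/- Let n ≥ 1 and let a_1, ..., a_n be real numbers such that the sum of the entries of every nonempty subset of {a_1, ..., a_n} is nonzero. Then for all real numbers x_1, ..., x_n such that x_j − x_i + a_i ≠ 0 for all ordered pairs i ≠ j, one has Θ(x_1, ..., x_n) = Σ_{G ∈ MS_n} β_G / ∏_{(i,j) ∈ E_G} (x_j − x_i + a_i), where the sum is over all multi-spine graphs G on the vertex set {1, ..., n}, E_G is the edge set of G, and β_G = (−1)^n · (∏_{j=1}^{n} a_j) / ∏_{S} ((−1) · Σ_{i ∈ S} a_i), the product being over the vertex sets S of the connected components of G. -/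
open Finset

open scoped Classical

/-- `Θ(x_1, ..., x_n)` with parameters `a_1, ..., a_n`. -/
noncomputable def Theta (n : ℕ) (a x : Fin n → ℝ) : ℝ :=
  ∏ i : Fin n, ∏ j ∈ univ.filter (fun j => i < j),
    ((x i - x j) * (x i - x j - a i + a j)) /
      ((x i - x j + a j) * (x i - x j - a i))

/-- The edge relation of a directed graph on `Fin n` given by its edge set. -/
def edgeRel (n : ℕ) (E : Finset (Fin n × Fin n)) (i j : Fin n) : Prop := (i, j) ∈ E

/-- A multi-spine graph: a directed graph each of whose connected components is a
directed path.  Equivalently: every vertex has out-degree at most one, in-degree at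
most one, and there are no directed cycles. -/
def IsMultiSpine (n : ℕ) (E : Finset (Fin n × Fin n)) : Prop :=
  (∀ i j j' : Fin n, (i, j) ∈ E → (i, j') ∈ E → j = j') ∧
  (∀ i i' j : Fin n, (i, j) ∈ E → (i', j) ∈ E → i = i') ∧
  (∀ i : Fin n, ¬ Relation.TransGen (edgeRel n E) i i)

/-- The starting points of the directed paths (vertices with no incoming edge);
they are in bijection with the connected components of a multi-spine graph. -/
noncomputable def spineHeads (n : ℕ) (E : Finset (Fin n × Fin n)) : Finset (Fin n) :=
  univ.filter (fun v => ∀ u, (u, v) ∉ E)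

/-- The vertex set of the connected component of a multi-spine graph containing the
head `v`: all vertices reachable from `v` along directed edges. -/
noncomputable def spineComponent (n : ℕ) (E : Finset (Fin n × Fin n)) (v : Fin n) :
    Finset (Fin n) :=
  univ.filter (fun w => Relation.ReflTransGen (edgeRel n E) v w)

/-- The constant `β_G`. -/
noncomputable def betaMS (n : ℕ) (a : Fin n → ℝ) (E : Finset (Fin n × Fin n)) : ℝ :=
  (-1 : ℝ) ^ n * (∏ j, a j) /
    ∏ v ∈ spineHeads n E, ((-1) * ∑ i ∈ spineComponent n E v, a i)

/-- The Cauchy determinant. -/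
theorem det_cauchy (n : ℕ) (u w : Fin n → ℝ) (h : ∀ i j, w j - u i ≠ 0) :
    (Matrix.of fun i j => (w j - u i)⁻¹).det =
      (∏ i, (w i - u i)⁻¹) * ∏ i, ∏ j ∈ univ.filter (fun j => i < j),
        ((w i - w j) * (u j - u i)) / ((w i - u j) * (w j - u i)) := by
  induction n with
  | zero => simp
  | succ n ih =>
    let B : Matrix (Fin (n + 1)) (Fin (n + 1)) ℝ := Matrix.of fun i j =>
      if i = 0 then (w j - u 0)⁻¹
      else (w j - u i)⁻¹ - (w 0 - u 0) / (w 0 - u i) * (w j - u 0)⁻¹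
    have hAB : (Matrix.of fun i j => (w j - u i)⁻¹).det = B.det := by
      refine Matrix.det_eq_of_forall_row_eq_smul_add_const
        (fun i => if i = 0 then 0 else (w 0 - u 0) / (w 0 - u i)) 0 (by simp) fun i j => ?_
      by_cases hi : i = 0 <;> simp [B, hi]
    have hB0 : ∀ i : Fin n, B i.succ 0 = 0 := by
      intro i
      have h1 := h i.succ 0
      have h2 := h 0 0
      simp only [B, Matrix.of_apply, Fin.succ_ne_zero, if_false]
      field_simp
      ring
    have hsub : B.submatrix Fin.succ Fin.succ = Matrix.of fun i j =>
        ((u i.succ - u 0) / (w 0 - u i.succ)) * (Matrix.of fun i j =>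
          ((w 0 - w j.succ) / (w j.succ - u 0)) * (Matrix.of fun i j : Fin n =>
            (w j.succ - u i.succ)⁻¹) i j) i j := by
      ext i j
      have h1 := h i.succ 0
      have h2 := h 0 j.succ
      have h3 := h i.succ j.succ
      simp only [B, Matrix.of_apply, Fin.succ_ne_zero, if_false, Matrix.submatrix_apply]
      field_simp
      ring
    have hfilter : univ.filter (fun j : Fin (n + 1) => 0 < j) = univ.map (Fin.succEmb n) := by
      ext j
      cases j using Fin.cases <;> simp
    have hfilter' : ∀ i : Fin n, univ.filter (fun j : Fin (n + 1) => i.succ < j) =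
        (univ.filter (fun j => i < j)).map (Fin.succEmb n) := by
      intro i
      ext j
      cases j using Fin.cases <;> simp
    rw [hAB, Matrix.det_succ_column_zero, Fin.sum_univ_succ]
    simp only [hB0, mul_zero, zero_mul, sum_const_zero, add_zero]
    change _ * (B.submatrix Fin.succ Fin.succ).det = _
    rw [hsub, Matrix.det_mul_column, Matrix.det_mul_row,
      ih (fun i => u i.succ) (fun i => w i.succ) fun i j => h _ _,
      Fin.prod_univ_succ, Fin.prod_univ_succ, hfilter]
    simp only [hfilter', prod_map, Fin.coe_succEmb, mul_div_mul_comm, prod_mul_distrib]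
    simp only [B, Matrix.of_apply, if_true, Fin.val_zero, pow_zero, one_mul, prod_div_distrib]
    ring

/-- A set meeting every cycle of `σ` (fixed points included) in exactly one element. -/
def IsCycleTransversal {α : Type*} (σ : Equiv.Perm α) (T : Finset α) : Prop :=
  ∀ i, ∃! t, t ∈ T ∧ σ.SameCycle i t

/-- The quotient of the ground set by the cycles of `σ`. -/
abbrev CycleQuotient {α : Type*} (σ : Equiv.Perm α) : Type _ :=
  Quotient (Equiv.Perm.SameCycle.setoid σ)

theorem cycleQuotient_mk_eq {α : Type*} {σ : Equiv.Perm α} {i j : α} :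
    (Quotient.mk _ i : CycleQuotient σ) = Quotient.mk _ j ↔ σ.SameCycle i j :=
  Quotient.eq

theorem IsCycleTransversal.eq {α : Type*} {σ : Equiv.Perm α} {T : Finset α}
    (hT : IsCycleTransversal σ T) {s t : α} (hs : s ∈ T) (ht : t ∈ T)
    (h : σ.SameCycle s t) : s = t :=
  (hT s).unique ⟨hs, .refl _ _⟩ ⟨ht, h⟩

theorem IsCycleTransversal.prod_eq {α : Type*} [Fintype α] {σ : Equiv.Perm α} {T : Finset α}
    (hT : IsCycleTransversal σ T) (g : CycleQuotient σ → ℝ) :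
    ∏ t ∈ T, g (Quotient.mk _ t) = ∏ q, g q := by
  refine prod_bij (fun t _ => Quotient.mk _ t) (fun _ _ => mem_univ _) ?_ ?_ fun _ _ => rfl
  · intro s hs t ht h
    exact hT.eq hs ht (cycleQuotient_mk_eq.1 h)
  · intro q _
    induction q using Quotient.inductionOn with
    | h i =>
      obtain ⟨t, ⟨ht, hit⟩, -⟩ := hT i
      exact ⟨t, ht, cycleQuotient_mk_eq.2 hit.symm⟩

theorem sum_cycleTransversal_prod {α : Type*} [Fintype α] (σ : Equiv.Perm α) (f : α → ℝ) :
    ∑ T ∈ univ.filter (IsCycleTransversal σ), ∏ t ∈ T, f t =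
      ∏ q : CycleQuotient σ, ∑ i ∈ univ.filter (fun i => Quotient.mk _ i = q), f i := by
  rw [prod_univ_sum]
  symm
  have key : ∀ p ∈ Fintype.piFinset
      (fun q : CycleQuotient σ => univ.filter (fun i : α => Quotient.mk _ i = q)),
      ∀ q, (Quotient.mk _ (p q) : CycleQuotient σ) = q := by
    intro p hp q
    simpa using Fintype.mem_piFinset.1 hp q
  refine sum_nbij (fun p => univ.image p) ?_ ?_ ?_ ?_
  · intro p hp
    have hk := key p hp
    refine mem_filter.2 ⟨mem_univ _, fun i => ⟨p (Quotient.mk _ i), ⟨by simp, ?_⟩, ?_⟩⟩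
    · exact cycleQuotient_mk_eq.1 (hk _).symm
    · rintro t ⟨ht, hit⟩
      obtain ⟨q, -, rfl⟩ := mem_image.1 ht
      rw [cycleQuotient_mk_eq.2 hit, hk]
  · intro p hp p' hp' h
    have hk := key p hp
    have hk' := key p' hp'
    funext q
    have : p q ∈ univ.image p' := by
      rw [← show univ.image p = univ.image p' from h]
      simp
    obtain ⟨q', -, hq'⟩ := mem_image.1 this
    have : q' = q := by rw [← hk' q', hq', hk]
    rw [← hq', this]
  · intro T hT
    have hT : IsCycleTransversal σ T := (mem_filter.1 hT).2
    have hex : ∀ q : CycleQuotient σ, ∃ t ∈ T, (Quotient.mk _ t : CycleQuotient σ) = q := by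
      intro q
      induction q using Quotient.inductionOn with
      | h i =>
        obtain ⟨t, ⟨ht, hit⟩, -⟩ := hT i
        exact ⟨t, ht, cycleQuotient_mk_eq.2 hit.symm⟩
    choose p hpT hpq using hex
    refine ⟨p, by simpa using hpq, ?_⟩
    ext t
    constructor
    · intro ht
      obtain ⟨q, -, rfl⟩ := mem_image.1 ht
      exact hpT q
    · intro ht
      refine mem_image.2 ⟨Quotient.mk _ t, mem_univ _, ?_⟩
      exact hT.eq (hpT _) ht (cycleQuotient_mk_eq.1 (hpq _))
  · intro p hp
    have hk := key p hp
    refine (prod_image ?_).symm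
    intro q _ q' _ h
    rw [← hk q, h, hk]

theorem IsCycleTransversal.sign_eq {α : Type*} [Fintype α] [DecidableEq α] {σ : Equiv.Perm α}
    {T : Finset α} (hT : IsCycleTransversal σ T) :
    ((Equiv.Perm.sign σ : ℤ) : ℝ) = (-1) ^ Fintype.card α * (-1) ^ T.card := by
  have hfix : T.filter (fun t => t ∉ σ.support) = univ \ σ.support := by
    ext i
    simp only [mem_filter, Equiv.Perm.mem_support, not_not, mem_sdiff, mem_univ, true_and,
      and_iff_right_iff_imp]
    intro hi
    obtain ⟨t, ⟨ht, hit⟩, -⟩ := hT i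
    rwa [hit.eq_of_left hi]
  have hmove : (T.filter (fun t => t ∈ σ.support)).card = σ.cycleType.card := by
    rw [Equiv.Perm.cycleType_def, Multiset.card_map]
    refine card_bij (fun t _ => σ.cycleOf t) ?_ ?_ ?_
    · intro t ht
      exact Equiv.Perm.cycleOf_mem_cycleFactorsFinset_iff.2 (mem_filter.1 ht).2
    · intro s hs t ht h
      rw [mem_filter] at hs ht
      exact hT.eq hs.1 ht.1 ((Equiv.Perm.sameCycle_iff_cycleOf_eq_of_mem_support hs.2 ht.2).2 h)
    · intro c hc
      obtain ⟨i, hi⟩ := (Equiv.Perm.mem_cycleFactorsFinset_iff.1 hc).1.nonempty_support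
      have hci := Equiv.Perm.cycle_is_cycleOf hi hc
      obtain ⟨t, ⟨ht, hit⟩, -⟩ := hT i
      have hi' : i ∈ σ.support := Equiv.Perm.mem_cycleFactorsFinset_support_le hc hi
      refine ⟨t, mem_filter.2 ⟨ht, ?_⟩, ?_⟩
      · rw [Equiv.Perm.mem_support] at hi' ⊢
        exact fun h => hi' ((hit.apply_eq_self_iff).2 h)
      · rw [hci, hit.cycleOf_eq]
  have hcard := card_filter_add_card_filter_not (s := T) (fun t => t ∈ σ.support)
  rw [hfix, hmove, card_sdiff_of_subset (subset_univ _), card_univ] at hcard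
  have hle : σ.support.card ≤ Fintype.card α := card_le_univ _
  rw [Equiv.Perm.sign_of_cycleType, Equiv.Perm.sum_cycleType, ← pow_add]
  push_cast
  rw [neg_one_pow_eq_pow_mod_two, neg_one_pow_eq_pow_mod_two (n := _ + T.card)]
  congr 1
  omega

/-- The graph obtained from the functional graph of `σ` by deleting the edges leaving `T`. -/
noncomputable def cutEdges {n : ℕ} (σ : Equiv.Perm (Fin n)) (T : Finset (Fin n)) :
    Finset (Fin n × Fin n) :=
  Tᶜ.image fun i => (i, σ i)

theorem mem_cutEdges {n : ℕ} {σ : Equiv.Perm (Fin n)} {T : Finset (Fin n)} {i j : Fin n} :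
    (i, j) ∈ cutEdges σ T ↔ i ∉ T ∧ σ i = j := by
  simp only [cutEdges, mem_image, mem_compl, Prod.mk.injEq]
  constructor
  · rintro ⟨k, hk, rfl, rfl⟩
    exact ⟨hk, rfl⟩
  · rintro ⟨hi, rfl⟩
    exact ⟨i, hi, rfl, rfl⟩

theorem mem_of_sameCycle {α : Type*} [Finite α] {σ : Equiv.Perm α} {P : α → Prop} {i j : α}
    (h : σ.SameCycle i j) (hi : P i) (hP : ∀ k, σ.SameCycle i k → P k → P (σ k)) : P j := by
  obtain ⟨m, rfl⟩ := h.exists_nat_pow_eq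
  clear h
  induction m with
  | zero => simpa using hi
  | succ m ih =>
    rw [pow_succ', Equiv.Perm.mul_apply]
    exact hP _ ⟨m, by simp⟩ ih

theorem sameCycle_of_reflTransGen {n : ℕ} {σ : Equiv.Perm (Fin n)} {E : Finset (Fin n × Fin n)}
    (hE : ∀ i j, (i, j) ∈ E → σ i = j) {i j : Fin n}
    (h : Relation.ReflTransGen (edgeRel n E) i j) : σ.SameCycle i j := by
  induction h with
  | refl => exact .refl _ _
  | tail _ hjk ih =>
    rw [← hE _ _ hjk]
    exact ih.apply_right

theorem IsCycleTransversal.isMultiSpine {n : ℕ} {σ : Equiv.Perm (Fin n)} {T : Finset (Fin n)}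
    (hT : IsCycleTransversal σ T) : IsMultiSpine n (cutEdges σ T) := by
  refine ⟨?_, ?_, ?_⟩
  · intro i j j' h h'
    rw [← (mem_cutEdges.1 h).2, (mem_cutEdges.1 h').2]
  · intro i i' j h h'
    exact σ.injective ((mem_cutEdges.1 h).2.trans (mem_cutEdges.1 h').2.symm)
  · intro i hi
    obtain ⟨t, ⟨ht, hit⟩, -⟩ := hT i
    have hcyc : Relation.TransGen (edgeRel n (cutEdges σ T)) t t := by
      refine mem_of_sameCycle
        (P := fun k => Relation.TransGen (edgeRel n (cutEdges σ T)) k k) hit hi ?_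
      intro k _ hk
      obtain ⟨j, hkj, hjk⟩ := Relation.TransGen.head'_iff.1 hk
      rw [(mem_cutEdges.1 hkj).2]
      exact Relation.TransGen.tail'_iff.2 ⟨k, hjk, hkj⟩
    obtain ⟨j, htj, -⟩ := Relation.TransGen.head'_iff.1 hcyc
    exact (mem_cutEdges.1 htj).1 ht

theorem spineHeads_cutEdges {n : ℕ} (σ : Equiv.Perm (Fin n)) (T : Finset (Fin n)) :
    spineHeads n (cutEdges σ T) = T.image σ := by
  ext v
  simp only [spineHeads, mem_filter, mem_univ, true_and, mem_image, mem_cutEdges, not_and]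
  constructor
  · intro h
    refine ⟨σ.symm v, ?_, by simp⟩
    by_contra hv
    exact h _ hv (by simp)
  · rintro ⟨t, ht, rfl⟩ u hu h
    exact hu (σ.injective h ▸ ht)

theorem IsCycleTransversal.reflTransGen_iff {n : ℕ} {σ : Equiv.Perm (Fin n)}
    {T : Finset (Fin n)} (hT : IsCycleTransversal σ T) {t w : Fin n} (ht : t ∈ T) :
    Relation.ReflTransGen (edgeRel n (cutEdges σ T)) (σ t) w ↔ σ.SameCycle t w := by
  constructor
  · intro h
    have := sameCycle_of_reflTransGen (fun i j h => (mem_cutEdges.1 h).2) h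
    exact this.of_apply_left
  · intro h
    have h' : σ.SameCycle (σ t) w := h.apply_left
    refine mem_of_sameCycle
      (P := fun k => Relation.ReflTransGen (edgeRel n (cutEdges σ T)) (σ t) k) h' .refl ?_
    intro k hk ih
    by_cases hkT : k ∈ T
    · rw [hT.eq ht hkT hk.of_apply_left]
    · exact ih.tail (mem_cutEdges.2 ⟨hkT, rfl⟩)

theorem IsMultiSpine.exists_head {n : ℕ} {E : Finset (Fin n × Fin n)} (hE : IsMultiSpine n E)
    (i : Fin n) : ∃ v ∈ spineHeads n E, Relation.ReflTransGen (edgeRel n E) v i := by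
  have hwf : WellFounded (Relation.TransGen (edgeRel n E)) := by
    have : Std.Irrefl (Relation.TransGen (edgeRel n E)) := ⟨hE.2.2⟩
    exact Finite.wellFounded_of_trans_of_irrefl _
  induction i using hwf.induction with
  | h i ih =>
    by_cases h : ∃ u, (u, i) ∈ E
    · obtain ⟨u, hu⟩ := h
      obtain ⟨v, hv, hvu⟩ := ih u (.single hu)
      exact ⟨v, hv, hvu.tail hu⟩
    · push Not at h
      exact ⟨i, by simpa [spineHeads] using h, .refl⟩

theorem eq_of_mem_spineHeads {n : ℕ} {E : Finset (Fin n × Fin n)} {u v : Fin n}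
    (hv : v ∈ spineHeads n E) (h : Relation.ReflTransGen (edgeRel n E) u v) : u = v := by
  obtain h | ⟨w, -, hwv⟩ := Relation.ReflTransGen.cases_tail h
  · exact h.symm
  · exact absurd hwv ((mem_filter.1 hv).2 w)

theorem IsMultiSpine.head_unique {n : ℕ} {E : Finset (Fin n × Fin n)} (hE : IsMultiSpine n E)
    {u v i : Fin n} (hu : u ∈ spineHeads n E) (hv : v ∈ spineHeads n E)
    (hui : Relation.ReflTransGen (edgeRel n E) u i)
    (hvi : Relation.ReflTransGen (edgeRel n E) v i) : u = v := by
  have hU : Relator.RightUnique (Function.swap (edgeRel n E)) :=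
    fun a b c hb hc => hE.2.1 b c a hb hc
  rcases Relation.ReflTransGen.total_of_right_unique hU
    (Relation.reflTransGen_swap.2 hui) (Relation.reflTransGen_swap.2 hvi) with h | h
  · exact (eq_of_mem_spineHeads hu (Relation.reflTransGen_swap.1 h)).symm
  · exact eq_of_mem_spineHeads hv (Relation.reflTransGen_swap.1 h)

theorem IsMultiSpine.tail_unique {n : ℕ} {E : Finset (Fin n × Fin n)} (hE : IsMultiSpine n E)
    {v i j : Fin n} (hi : ∀ k, (i, k) ∉ E) (hj : ∀ k, (j, k) ∉ E)
    (hvi : Relation.ReflTransGen (edgeRel n E) v i)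
    (hvj : Relation.ReflTransGen (edgeRel n E) v j) : i = j := by
  have hU : Relator.RightUnique (edgeRel n E) := fun a b c hb hc => hE.1 a b c hb hc
  rcases Relation.ReflTransGen.total_of_right_unique hU hvi hvj with h | h
  · obtain h | ⟨k, hik, -⟩ := Relation.ReflTransGen.cases_head h
    · exact h
    · exact absurd hik (hi k)
  · obtain h | ⟨k, hjk, -⟩ := Relation.ReflTransGen.cases_head h
    · exact h.symm
    · exact absurd hjk (hj k)

/-- Closing each path of a multi-spine graph into a cycle yields a permutation. -/
theorem IsMultiSpine.exists_cutEdges_eq {n : ℕ} {E : Finset (Fin n × Fin n)}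
    (hE : IsMultiSpine n E) :
    ∃ (σ : Equiv.Perm (Fin n)) (T : Finset (Fin n)),
      IsCycleTransversal σ T ∧ cutEdges σ T = E := by
  have hnext : ∀ i, ∃ j, (i, j) ∈ E ∨ (∀ k, (i, k) ∉ E) ∧ j ∈ spineHeads n E ∧
      Relation.ReflTransGen (edgeRel n E) j i := by
    intro i
    by_cases h : ∃ j, (i, j) ∈ E
    · exact h.imp fun _ => Or.inl
    · push Not at h
      obtain ⟨v, hv, hvi⟩ := hE.exists_head i
      exact ⟨v, Or.inr ⟨h, hv, hvi⟩⟩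
  choose f hf using hnext
  have hinj : Function.Injective f := by
    intro i j hij
    have hi := hf i
    have hj := hf j
    rw [← hij] at hj
    rcases hi with hi | ⟨hi, hvi, hri⟩ <;> rcases hj with hj | ⟨hj, hvj, hrj⟩
    · exact hE.2.1 _ _ _ hi hj
    · exact absurd hi ((mem_filter.1 hvj).2 i)
    · exact absurd hj ((mem_filter.1 hvi).2 j)
    · exact hE.tail_unique hi hj hri hrj
  let σ : Equiv.Perm (Fin n) := Equiv.ofBijective f (Finite.injective_iff_bijective.1 hinj)
  have hσE : ∀ i j, (i, j) ∈ E → σ i = j := by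
    intro i j hij
    rcases hf i with h | ⟨h, -⟩
    · exact hE.1 _ _ _ h hij
    · exact absurd hij (h j)
  have hσ : ∀ i, (∀ k, (i, k) ∉ E) → σ i ∈ spineHeads n E ∧
      Relation.ReflTransGen (edgeRel n E) (σ i) i := by
    intro i hi
    rcases hf i with h | ⟨-, h⟩
    · exact absurd h (hi _)
    · exact h
  have hreach : ∀ v ∈ spineHeads n E, ∀ w, σ.SameCycle v w →
      Relation.ReflTransGen (edgeRel n E) v w := by
    intro v hv w hvw
    refine mem_of_sameCycle
      (P := fun k => Relation.ReflTransGen (edgeRel n E) v k) hvw .refl ?_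
    intro k _ ih
    by_cases h : ∃ j, (k, j) ∈ E
    · obtain ⟨j, hj⟩ := h
      rw [hσE k j hj]
      exact ih.tail hj
    · push Not at h
      rw [hE.head_unique hv (hσ k h).1 ih (hσ k h).2]
  refine ⟨σ, univ.filter fun i => ∀ k, (i, k) ∉ E, ?_, ?_⟩
  · intro i
    obtain ⟨v, hv, hvi⟩ := hE.exists_head i
    have hvi' := sameCycle_of_reflTransGen hσE hvi
    refine ⟨σ.symm v, ⟨mem_filter.2 ⟨mem_univ _, ?_⟩, ?_⟩, ?_⟩
    · intro k hk
      obtain rfl : v = k := by simpa using hσE _ _ hk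
      exact (mem_filter.1 hv).2 _ hk
    · have : σ.SameCycle (σ.symm v) v := by
        simpa using (Equiv.Perm.SameCycle.refl σ (σ.symm v)).apply_right
      exact (this.trans hvi').symm
    · rintro t ⟨ht, hit⟩
      obtain ⟨h1, h2⟩ := hσ t (mem_filter.1 ht).2
      rw [Equiv.eq_symm_apply]
      exact hE.head_unique h1 hv h2 (hreach v hv t (hvi'.trans hit))
  · ext ⟨i, j⟩
    rw [mem_cutEdges]
    simp only [mem_filter, mem_univ, true_and, not_forall, not_not]
    constructor
    · rintro ⟨⟨k, hk⟩, rfl⟩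
      rwa [hσE i k hk]
    · intro h
      exact ⟨⟨j, h⟩, hσE i j h⟩

theorem IsCycleTransversal.cutEdges_injective {n : ℕ} {σ σ' : Equiv.Perm (Fin n)}
    {T T' : Finset (Fin n)} (hT : IsCycleTransversal σ T) (hT' : IsCycleTransversal σ' T')
    (h : cutEdges σ T = cutEdges σ' T') : σ = σ' ∧ T = T' := by
  have hTT : T = T' := by
    ext i
    have h1 : (∃ j, (i, j) ∈ cutEdges σ T) ↔ ∃ j, (i, j) ∈ cutEdges σ' T' := by rw [h]
    simpa [mem_cutEdges, not_iff_not] using h1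
  refine ⟨?_, hTT⟩
  ext1 i
  by_cases hi : i ∈ T
  · have h1 : σ i ∈ spineHeads n (cutEdges σ T) := by
      rw [spineHeads_cutEdges]
      exact mem_image_of_mem _ hi
    have h2 : σ' i ∈ spineHeads n (cutEdges σ T) := by
      rw [h, spineHeads_cutEdges]
      exact mem_image_of_mem _ (hTT ▸ hi)
    refine hT.isMultiSpine.head_unique h1 h2 ((hT.reflTransGen_iff hi).2 (.refl _ _)) ?_
    rw [h]
    exact (hT'.reflTransGen_iff (hTT ▸ hi)).2 (.refl _ _)
  · have : (i, σ i) ∈ cutEdges σ' T' := h ▸ mem_cutEdges.2 ⟨hi, rfl⟩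
    exact (mem_cutEdges.1 this).2.symm

theorem sum_isMultiSpine {n : ℕ} (g : Finset (Fin n × Fin n) → ℝ) :
    ∑ E ∈ univ.filter (IsMultiSpine n), g E =
      ∑ σ : Equiv.Perm (Fin n), ∑ T ∈ univ.filter (IsCycleTransversal σ), g (cutEdges σ T) := by
  rw [sum_sigma']
  symm
  refine sum_bij (fun p _ => cutEdges p.1 p.2) ?_ ?_ ?_ fun _ _ => rfl
  · rintro ⟨σ, T⟩ hp
    simp only [mem_sigma, mem_filter, mem_univ, true_and] at hp ⊢
    exact hp.isMultiSpine
  · rintro ⟨σ, T⟩ hp ⟨σ', T'⟩ hp' h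
    simp only [mem_sigma, mem_filter, mem_univ, true_and] at hp hp'
    obtain ⟨rfl, rfl⟩ := hp.cutEdges_injective hp' h
    rfl
  · intro E hE
    obtain ⟨σ, T, hT, rfl⟩ := (mem_filter.1 hE).2.exists_cutEdges_eq
    exact ⟨⟨σ, T⟩, by simpa using hT, rfl⟩

/-- The denominator of `betaMS` for a graph obtained by cutting the cycles of `σ`. -/
theorem IsCycleTransversal.prod_spineHeads {n : ℕ} {σ : Equiv.Perm (Fin n)}
    {T : Finset (Fin n)} (hT : IsCycleTransversal σ T) (a : Fin n → ℝ) :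
    ∏ v ∈ spineHeads n (cutEdges σ T), ((-1) * ∑ i ∈ spineComponent n (cutEdges σ T) v, a i) =
      (-1) ^ T.card * ∏ q : CycleQuotient σ,
        ∑ i ∈ univ.filter (fun i => Quotient.mk _ i = q), a i := by
  rw [spineHeads_cutEdges, prod_image σ.injective.injOn, prod_mul_distrib, prod_const,
    ← hT.prod_eq]
  congr 1
  refine prod_congr rfl fun t ht => sum_congr ?_ fun _ _ => rfl
  ext w
  simp only [spineComponent, mem_filter, mem_univ, true_and]
  rw [hT.reflTransGen_iff ht, cycleQuotient_mk_eq]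
  exact Equiv.Perm.sameCycle_comm

theorem prod_cutEdges {n : ℕ} (σ : Equiv.Perm (Fin n)) (T : Finset (Fin n))
    (F : Fin n × Fin n → ℝ) : ∏ e ∈ cutEdges σ T, F e = ∏ i ∈ Tᶜ, F (i, σ i) :=
  prod_image fun _ _ _ _ h => congrArg Prod.fst h

theorem sum_cycle_sub {n : ℕ} (σ : Equiv.Perm (Fin n)) (a x : Fin n → ℝ) (q : CycleQuotient σ) :
    ∑ i ∈ univ.filter (fun i => Quotient.mk _ i = q), (x (σ i) - x i + a i) =
      ∑ i ∈ univ.filter (fun i => Quotient.mk _ i = q), a i := by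
  have h : ∑ i ∈ univ.filter (fun i => Quotient.mk _ i = q), x (σ i) =
      ∑ i ∈ univ.filter (fun i => Quotient.mk _ i = q), x i := by
    refine sum_equiv σ ?_ fun _ _ => rfl
    intro i
    have : (Quotient.mk _ i : CycleQuotient σ) = Quotient.mk _ (σ i) :=
      cycleQuotient_mk_eq.2 (Equiv.Perm.SameCycle.refl σ i).apply_right
    simp [this]
  rw [sum_add_distrib, sum_sub_distrib, h]
  ring

theorem sum_cycleTransversal_beta {n : ℕ} (a x : Fin n → ℝ) (σ : Equiv.Perm (Fin n))
    (ha : ∀ S : Finset (Fin n), S.Nonempty → ∑ i ∈ S, a i ≠ 0)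
    (hF : ∀ i j : Fin n, x j - x i + a i ≠ 0) :
    ∑ T ∈ univ.filter (IsCycleTransversal σ),
        betaMS n a (cutEdges σ T) / ∏ e ∈ cutEdges σ T, (x e.2 - x e.1 + a e.1) =
      (∏ j, a j) * ((Equiv.Perm.sign σ : ℤ) * ∏ i, (x (σ i) - x i + a i)⁻¹) := by
  set A := ∏ q : CycleQuotient σ, ∑ i ∈ univ.filter (fun i => Quotient.mk _ i = q), a i with hA
  have hA0 : A ≠ 0 := by
    refine prod_ne_zero_iff.2 fun q _ => ha _ ?_
    obtain ⟨i, rfl⟩ := Quotient.exists_rep q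
    exact ⟨i, by simp⟩
  have hterm : ∀ T ∈ univ.filter (IsCycleTransversal σ),
      betaMS n a (cutEdges σ T) / ∏ e ∈ cutEdges σ T, (x e.2 - x e.1 + a e.1) =
        (∏ j, a j) * ((Equiv.Perm.sign σ : ℤ) * ∏ i, (x (σ i) - x i + a i)⁻¹) * A⁻¹ *
          ∏ t ∈ T, (x (σ t) - x t + a t) := by
    intro T hT
    have hT : IsCycleTransversal σ T := (mem_filter.1 hT).2
    have h1 : ∏ i ∈ Tᶜ, (x (σ i) - x i + a i) ≠ 0 := prod_ne_zero_iff.2 fun i _ => hF _ _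
    have h2 : ∏ i ∈ T, (x (σ i) - x i + a i) ≠ 0 := prod_ne_zero_iff.2 fun i _ => hF _ _
    have h3 : ((-1 : ℝ) ^ T.card) * (-1) ^ T.card = 1 := by
      rw [← mul_pow]
      simp
    have h4 : ((-1 : ℝ) ^ T.card) ≠ 0 := by positivity
    rw [betaMS, hT.prod_spineHeads, prod_cutEdges, hT.sign_eq, prod_inv_distrib,
      ← prod_mul_prod_compl T fun i => x (σ i) - x i + a i, Fintype.card_fin, ← hA]
    field_simp
    linear_combination -(∏ j, a j) * h3
  rw [sum_congr rfl hterm, ← mul_sum, sum_cycleTransversal_prod]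
  simp only [sum_cycle_sub]
  rw [← hA, mul_assoc, inv_mul_cancel₀ hA0, mul_one]

/-- Decomposition of `Θ` into simple fractions, as a sum over multi-spine graphs. -/
theorem theta_eq_sum_multiSpine (n : ℕ) (hn : 1 ≤ n) (a x : Fin n → ℝ)
    (ha : ∀ S : Finset (Fin n), S.Nonempty → ∑ i ∈ S, a i ≠ 0)
    (hx : ∀ i j : Fin n, i ≠ j → x j - x i + a i ≠ 0) :
    Theta n a x =
      ∑ E ∈ univ.filter (IsMultiSpine n),
        betaMS n a E / ∏ e ∈ E, (x e.2 - x e.1 + a e.1) := by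
  have hF : ∀ i j : Fin n, x j - x i + a i ≠ 0 := by
    intro i j
    by_cases hij : i = j
    · subst hij
      simpa using ha {i} (singleton_nonempty i)
    · exact hx i j hij
  have hdet : Theta n a x =
      (∏ j, a j) * (Matrix.of fun i j => (x j - (x i - a i))⁻¹).det := by
    rw [det_cauchy n (fun i => x i - a i) x fun i j => by
      simpa [sub_add] using hF i j, ← mul_assoc, ← prod_mul_distrib]
    have h1 : ∏ i, a i * (x i - (x i - a i))⁻¹ = 1 := by
      refine prod_eq_one fun i _ => ?_
      rw [sub_sub_cancel]
      exact mul_inv_cancel₀ (by simpa using hF i i)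
    rw [h1, one_mul, Theta]
    refine prod_congr rfl fun i _ => prod_congr rfl fun j _ => ?_
    rw [← neg_div_neg_eq]
    congr 1 <;> ring
  rw [hdet, ← Matrix.det_transpose, Matrix.det_apply', mul_sum, sum_isMultiSpine]
  refine sum_congr rfl fun σ _ => ?_
  rw [sum_cycleTransversal_beta a x σ ha hF]
  simp only [Matrix.transpose_apply, Matrix.of_apply, sub_add]
end

section
/- Fix a real number u_0. Let n ≥ 2 and let x_1, ..., x_n be real numbers such that x_m − x_i + (m − i) ≠ 0 for all 1 ≤ i < m ≤ n. If x_n ≤ u_0 then 𝔗_n(x_1, ..., x_n) = 0, and if x_n > u_0 then 𝔗_n(x_1, ..., x_n) = ( Σ_{i=2}^{n−1} 𝔗_{i−1}(x_1, ..., x_{i−1}) · 𝔗_{n−i+1}(x_i, ..., x_n) + 𝔗_{n−1}(x_1, ..., x_{n−1}) ) / (x_n − x_1 + n − 1). -/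
open Finset

open scoped Classical

/-- The underlying undirected adjacency relation of an edge set. -/
def adjRel (E : Finset (ℕ × ℕ)) (v w : ℕ) : Prop := (v, w) ∈ E ∨ (w, v) ∈ E

/-- `E` is the edge set of a non-crossing alternating tree on `{1, ..., n}`:
the edges `(i, m)` satisfy `1 ≤ i < m ≤ n`; there are `n - 1` edges and the graph
is connected (hence a tree); no two edges `{i, m}` and `{k, l}` satisfy
`i < k < m < l` (non-crossing); and no vertex has both an incoming and an
outgoing edge, i.e. every vertex is either smaller than all of its neighbours or
larger than all of its neighbours (alternating). -/
def IsNCATree (n : ℕ) (E : Finset (ℕ × ℕ)) : Prop :=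
  (∀ e ∈ E, 1 ≤ e.1 ∧ e.1 < e.2 ∧ e.2 ≤ n) ∧
  E.card = n - 1 ∧
  (∀ v w : ℕ, 1 ≤ v → v ≤ n → 1 ≤ w → w ≤ n →
    Relation.ReflTransGen (adjRel E) v w) ∧
  (∀ e ∈ E, ∀ e' ∈ E, ¬ (e.1 < e'.1 ∧ e'.1 < e.2 ∧ e.2 < e'.2)) ∧
  (∀ i v m : ℕ, (i, v) ∈ E → (v, m) ∈ E → False)

/-- The black vertices of a non-crossing alternating tree: the vertices which are
smaller than all of their neighbours (no incoming edge); for `n = 1` the unique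
vertex is black. The remaining vertices of `{1, ..., n}` are white. -/
noncomputable def blackSet (n : ℕ) (E : Finset (ℕ × ℕ)) : Finset ℕ :=
  (Finset.Icc 1 n).filter (fun v => ∀ i, (i, v) ∉ E)

/-- `𝔗_n(x_1, ..., x_n) = Σ_T (-1)^{|B_T|} f_T(x_1, ..., x_n)`, the sum being over
the non-crossing alternating trees `T` on `{1, ..., n}` such that `x_v ≤ u₀` for
every black vertex `v` and `x_v > u₀` for every white vertex `v`, where
`f_T(x_1, ..., x_n) = ∏_{(i,m) edge} 1/(x_m - x_i + (m - i))`. -/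
noncomputable def TFun (u₀ : ℝ) (n : ℕ) (x : ℕ → ℝ) : ℝ :=
  ∑ E ∈ (((Finset.Icc 1 n) ×ˢ (Finset.Icc 1 n)).powerset).filter
      (fun E => IsNCATree n E ∧ (∀ v ∈ blackSet n E, x v ≤ u₀) ∧
        (∀ v ∈ Finset.Icc 1 n, v ∉ blackSet n E → u₀ < x v)),
    (-1 : ℝ) ^ (blackSet n E).card *
      ∏ e ∈ E, 1 / (x e.2 - x e.1 + ((e.2 : ℝ) - (e.1 : ℝ)))

/-- `E` is the edge set of a connected non-crossing alternating graph on `{a, ..., b}`. -/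
structure IsNCAOn (a b : ℕ) (E : Finset (ℕ × ℕ)) : Prop where
  bounds : ∀ e ∈ E, a ≤ e.1 ∧ e.1 < e.2 ∧ e.2 ≤ b
  conn : ∀ v w : ℕ, a ≤ v → v ≤ b → a ≤ w → w ≤ b → Relation.ReflTransGen (adjRel E) v w
  noncross : ∀ e ∈ E, ∀ e' ∈ E, ¬ (e.1 < e'.1 ∧ e'.1 < e.2 ∧ e.2 < e'.2)
  alt : ∀ i v m : ℕ, (i, v) ∈ E → (v, m) ∈ E → False

lemma adjRel_mono {E F : Finset (ℕ × ℕ)} (h : E ⊆ F) {v w : ℕ} (hvw : adjRel E v w) :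
    adjRel F v w :=
  hvw.imp (fun h' => h h') (fun h' => h h')

lemma adjRel_symm {E : Finset (ℕ × ℕ)} {v w : ℕ} (h : adjRel E v w) : adjRel E w v :=
  Or.symm h

lemma reflTransGen_adjRel_symm {E : Finset (ℕ × ℕ)} {v w : ℕ}
    (h : Relation.ReflTransGen (adjRel E) v w) : Relation.ReflTransGen (adjRel E) w v :=
  h.rec .refl fun _ hbc ih => ih.head (adjRel_symm hbc)

lemma reflTransGen_adjRel_closed {E : Finset (ℕ × ℕ)} {P : ℕ → Prop}
    (hP : ∀ e ∈ E, P e.1 ↔ P e.2) {v w : ℕ}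
    (h : Relation.ReflTransGen (adjRel E) v w) (hv : P v) : P w := by
  induction h with
  | refl => exact hv
  | tail _ hbc ih =>
    rcases hbc with h | h
    · exact (hP _ h).1 ih
    · exact (hP _ h).2 ih

/-- Map a path in `E` along `f`, which sends every edge of `E` to an edge of `F` or to a point. -/
lemma reflTransGen_adjRel_map {E F : Finset (ℕ × ℕ)} (f : ℕ → ℕ)
    (hf : ∀ p q, (p, q) ∈ E → f p = f q ∨ (f p, f q) ∈ F) {v w : ℕ}
    (h : Relation.ReflTransGen (adjRel E) v w) :
    Relation.ReflTransGen (adjRel F) (f v) (f w) := by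
  induction h with
  | refl => exact .refl
  | @tail p q _ hpq ih =>
    rcases hpq with h | h
    · rcases hf _ _ h with h' | h'
      · rwa [← h']
      · exact ih.tail (Or.inl h')
    · rcases hf _ _ h with h' | h'
      · rwa [h']
      · exact ih.tail (Or.inr h')

namespace IsNCAOn

variable {a b m : ℕ} {E L R : Finset (ℕ × ℕ)}

/-- The subgraph `F` does not cross the cut after the largest neighbour of `a` in `F`. -/
lemma exists_cut (h : IsNCAOn a b E) {F : Finset (ℕ × ℕ)} (hF : F ⊆ E) :
    ∃ m, (m = a ∨ (a, m) ∈ F) ∧ ∀ e ∈ F, e.2 ≤ m ∨ m < e.1 := by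
  have hne : (insert a ((F.filter (fun e => e.1 = a)).image Prod.snd)).Nonempty :=
    insert_nonempty _ _
  obtain ⟨m, hm, hmax⟩ := exists_max_image _ id hne
  have hm' : m = a ∨ (a, m) ∈ F := by simpa using hm
  refine ⟨m, hm', ?_⟩
  rintro ⟨p, q⟩ hpq
  by_contra! hcon
  simp only at hcon
  have hb := h.bounds _ (hF hpq)
  simp only at hb
  by_cases hpa : p = a
  · subst hpa
    have := hmax q (by simp [hpq])
    simp only [id] at this
    omega
  · rcases hm' with rfl | hm'
    · omega
    · rcases hcon.2.lt_or_eq with hlt | rfl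
      · exact h.noncross _ (hF hm') _ (hF hpq) ⟨by simp only; omega, hlt, hcon.1⟩
      · exact h.alt _ _ _ (hF hm') (hF hpq)

lemma top_mem (h : IsNCAOn a b E) (hab : a < b) : (a, b) ∈ E := by
  obtain ⟨m, hm, hcut⟩ := h.exists_cut (Subset.refl E)
  have hmb : m = b := by
    by_contra hmb
    have hlt : a ≤ m ∧ m < b := by
      rcases hm with rfl | hm
      · omega
      · have := h.bounds _ hm
        simp only at this
        omega
    have := reflTransGen_adjRel_closed (P := fun v => v ≤ m) (fun e he => by
      have := hcut e he
      have := h.bounds e he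
      constructor <;> intro <;> omega) (h.conn a b le_rfl hab.le hab.le le_rfl) hlt.1
    omega
  subst hmb
  rcases hm with rfl | hm
  · omega
  · exact hm

lemma exists_split (h : IsNCAOn a b E) (hab : a < b) :
    ∃ m, a ≤ m ∧ m < b ∧ ∀ e ∈ E, e = (a, b) ∨ e.2 ≤ m ∨ m < e.1 := by
  obtain ⟨m, hm, hcut⟩ := h.exists_cut (erase_subset (a, b) E)
  have hlt : a ≤ m ∧ m < b := by
    rcases hm with rfl | hm
    · omega
    · have := h.bounds _ (mem_of_mem_erase hm)
      have hne : m ≠ b := by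
        rintro rfl
        simp at hm
      simp only at this
      omega
  refine ⟨m, hlt.1, hlt.2, fun e he => ?_⟩
  by_cases hee : e = (a, b)
  · exact Or.inl hee
  · exact Or.inr (hcut e (mem_erase.2 ⟨hee, he⟩))

lemma left (h : IsNCAOn a b E) (ham : a ≤ m) (hmb : m < b)
    (hs : ∀ e ∈ E, e = (a, b) ∨ e.2 ≤ m ∨ m < e.1) :
    IsNCAOn a m (E.filter (fun e => e.2 ≤ m)) where
  bounds e he := by
    rw [mem_filter] at he
    have := h.bounds e he.1
    omega
  conn v w hv hv' hw hw' := by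
    have := reflTransGen_adjRel_map (F := E.filter (fun e => e.2 ≤ m))
      (fun t => if t ≤ m then t else a) (fun p q hpq => ?_)
      (h.conn v w hv (by omega) hw (by omega))
    · simpa [hv', hw'] using this
    · have hb := h.bounds _ hpq
      rcases hs _ hpq with h' | h' | h'
      · simp only [Prod.mk.injEq] at h'
        obtain ⟨rfl, rfl⟩ := h'
        left
        simp [hmb.not_ge]
      · right
        simp only at h' hb
        simp [h', hpq, show p ≤ m by omega]
      · left
        simp only at h' hb
        simp [h'.not_ge, show ¬ q ≤ m by omega]
  noncross e he e' he' := h.noncross e (mem_of_mem_filter e he) e' (mem_of_mem_filter e' he')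
  alt i v w h₁ h₂ := h.alt i v w (mem_of_mem_filter _ h₁) (mem_of_mem_filter _ h₂)

lemma right (h : IsNCAOn a b E) (ham : a ≤ m) (hmb : m < b)
    (hs : ∀ e ∈ E, e = (a, b) ∨ e.2 ≤ m ∨ m < e.1) :
    IsNCAOn (m + 1) b (E.filter (fun e => m < e.1)) where
  bounds e he := by
    rw [mem_filter] at he
    have := h.bounds e he.1
    omega
  conn v w hv hv' hw hw' := by
    have := reflTransGen_adjRel_map (F := E.filter (fun e => m < e.1))
      (fun t => if m < t then t else b) (fun p q hpq => ?_)
      (h.conn v w (by omega) (by omega) (by omega) (by omega))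
    · simpa [show m < v by omega, show m < w by omega] using this
    · have hb := h.bounds _ hpq
      rcases hs _ hpq with h' | h' | h'
      · simp only [Prod.mk.injEq] at h'
        obtain ⟨rfl, rfl⟩ := h'
        left
        simp [ham.not_gt]
      · left
        simp only at h' hb
        simp [h'.not_gt, show ¬ m < p by omega]
      · right
        simp only at h' hb
        simp [h', hpq, show m < q by omega]
  noncross e he e' he' := h.noncross e (mem_of_mem_filter e he) e' (mem_of_mem_filter e' he')
  alt i v w h₁ h₂ := h.alt i v w (mem_of_mem_filter _ h₁) (mem_of_mem_filter _ h₂)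

lemma eq_insert_union (h : IsNCAOn a b E) (hab : a < b)
    (hs : ∀ e ∈ E, e = (a, b) ∨ e.2 ≤ m ∨ m < e.1) :
    insert (a, b) (E.filter (fun e => e.2 ≤ m) ∪ E.filter (fun e => m < e.1)) = E := by
  ext e
  simp only [mem_insert, mem_union, mem_filter]
  constructor
  · rintro (rfl | h' | h')
    exacts [h.top_mem hab, h'.1, h'.1]
  · intro he
    have := hs e he
    tauto

lemma top_notMem_union (hL : IsNCAOn a m L) (hR : IsNCAOn (m + 1) b R)
    (ham : a ≤ m) (hmb : m < b) : (a, b) ∉ L ∪ R := by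
  rw [mem_union]
  rintro (h | h)
  · have := hL.bounds _ h
    simp only at this
    omega
  · have := hR.bounds _ h
    simp only at this
    omega

lemma disjoint_left_right (hL : IsNCAOn a m L) (hR : IsNCAOn (m + 1) b R) : Disjoint L R := by
  rw [Finset.disjoint_left]
  intro e h₁ h₂
  have := hL.bounds _ h₁
  have := hR.bounds _ h₂
  omega

lemma card_eq (h : IsNCAOn a b E) (hab : a ≤ b) : E.card = b - a := by
  induction hd : b - a using Nat.strong_induction_on generalizing a b E with
  | _ d ih =>
    rcases hab.eq_or_lt with rfl | hlt
    · have : E = ∅ := by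
        rw [eq_empty_iff_forall_notMem]
        intro e he
        have := h.bounds e he
        omega
      simp [this, ← hd]
    · obtain ⟨m, ham, hmb, hs⟩ := h.exists_split hlt
      have hL := h.left ham hmb hs
      have hR := h.right ham hmb hs
      have h₁ := ih (m - a) (by omega) hL ham rfl
      have h₂ := ih (b - (m + 1)) (by omega) hR (by omega) rfl
      rw [← h.eq_insert_union hlt hs, card_insert_of_notMem (top_notMem_union hL hR ham hmb),
        card_union_of_disjoint (disjoint_left_right hL hR), h₁, h₂]
      omega

lemma glue (hL : IsNCAOn a m L) (hR : IsNCAOn (m + 1) b R) (ham : a ≤ m) (hmb : m < b) :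
    IsNCAOn a b (insert (a, b) (L ∪ R)) where
  bounds e he := by
    rw [mem_insert, mem_union] at he
    rcases he with rfl | he | he
    · exact ⟨le_rfl, by simp only; omega, le_rfl⟩
    · have := hL.bounds e he
      omega
    · have := hR.bounds e he
      omega
  conn := by
    have key : ∀ v, a ≤ v → v ≤ b →
        Relation.ReflTransGen (adjRel (insert (a, b) (L ∪ R))) a v := by
      intro v hv hv'
      by_cases hvm : v ≤ m
      · exact (hL.conn a v le_rfl ham hv hvm).lift id fun _ _ h =>
          adjRel_mono (subset_union_left.trans (subset_insert _ _)) h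
      · refine Relation.ReflTransGen.head (b := b) (Or.inl (mem_insert_self _ _)) ?_
        exact (hR.conn b v hmb le_rfl (by omega) hv').lift id fun _ _ h =>
          adjRel_mono (subset_union_right.trans (subset_insert _ _)) h
    exact fun v w hv hv' hw hw' => (reflTransGen_adjRel_symm (key v hv hv')).trans (key w hw hw')
  noncross e he e' he' := by
    rw [mem_insert, mem_union] at he he'
    rintro ⟨h₁, h₂, h₃⟩
    rcases he with rfl | he | he <;> rcases he' with rfl | he' | he'
    · simp at h₁
    · have := hL.bounds _ he'
      simp only at h₃
      omega
    · have := hR.bounds _ he'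
      simp only at h₃
      omega
    · have := hL.bounds _ he
      simp only at h₁
      omega
    · exact hL.noncross _ he _ he' ⟨h₁, h₂, h₃⟩
    · have := hL.bounds _ he
      have := hR.bounds _ he'
      omega
    · have := hR.bounds _ he
      simp only at h₁
      omega
    · have := hR.bounds _ he
      have := hL.bounds _ he'
      omega
    · exact hR.noncross _ he _ he' ⟨h₁, h₂, h₃⟩
  alt i v w h₁ h₂ := by
    simp only [mem_insert, mem_union, Prod.mk.injEq] at h₁ h₂
    have b₁ := fun e he => hL.bounds e he
    have b₂ := fun e he => hR.bounds e he
    simp only [Prod.forall] at b₁ b₂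
    rcases h₁ with h₁ | h₁ | h₁ <;> rcases h₂ with h₂ | h₂ | h₂
    · omega
    · have := b₁ _ _ h₂
      omega
    · have := b₂ _ _ h₂
      omega
    · have := b₁ _ _ h₁
      omega
    · exact hL.alt _ _ _ h₁ h₂
    · have := b₁ _ _ h₁
      have := b₂ _ _ h₂
      omega
    · have := b₂ _ _ h₁
      omega
    · have := b₂ _ _ h₁
      have := b₁ _ _ h₂
      omega
    · exact hR.alt _ _ _ h₁ h₂

lemma filter_le_glue (hL : IsNCAOn a m L) (hR : IsNCAOn (m + 1) b R) (hmb : m < b) :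
    (insert (a, b) (L ∪ R)).filter (fun e => e.2 ≤ m) = L := by
  ext e
  have h₁ := hL.bounds e
  have h₂ := hR.bounds e
  simp only [mem_filter, mem_insert, mem_union]
  constructor
  · rintro ⟨rfl | h | h, h'⟩
    · simp only at h'
      omega
    · exact h
    · have := h₂ h
      omega
  · exact fun h => ⟨Or.inr (Or.inl h), (h₁ h).2.2⟩

lemma filter_lt_glue (hL : IsNCAOn a m L) (hR : IsNCAOn (m + 1) b R) (ham : a ≤ m) :
    (insert (a, b) (L ∪ R)).filter (fun e => m < e.1) = R := by
  ext e
  have h₁ := hL.bounds e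
  have h₂ := hR.bounds e
  simp only [mem_filter, mem_insert, mem_union]
  constructor
  · rintro ⟨rfl | h | h, h'⟩
    · simp only at h'
      omega
    · have := h₁ h
      omega
    · exact h
  · exact fun h => ⟨Or.inr (Or.inr h), (h₂ h).1⟩

/-- The position of the cut is determined by the glued graph. -/
lemma cut_le_of_glue_eq {m' : ℕ} {L' R' : Finset (ℕ × ℕ)}
    (hL : IsNCAOn a m L) (hR : IsNCAOn (m + 1) b R)
    (hL' : IsNCAOn a m' L')
    (ham : a ≤ m) (ham' : a ≤ m') (hmb' : m' < b)
    (heq : insert (a, b) (L ∪ R) = insert (a, b) (L' ∪ R')) : m' ≤ m := by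
  by_contra! hlt
  have := reflTransGen_adjRel_closed (P := fun v => v ≤ m) (fun e he => by
    have hb := hL'.bounds e he
    have : e ∈ insert (a, b) (L ∪ R) := by
      rw [heq]
      simp [he]
    rw [mem_insert, mem_union] at this
    rcases this with rfl | h | h
    · simp only at hb
      omega
    · have := hL.bounds e h
      constructor <;> intro <;> omega
    · have := hR.bounds e h
      constructor <;> intro <;> omega)
    (hL'.conn a m' le_rfl ham' ham' le_rfl) ham
  omega

end IsNCAOn

lemma isNCATree_iff {n : ℕ} (hn : 1 ≤ n) {E : Finset (ℕ × ℕ)} :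
    IsNCATree n E ↔ IsNCAOn 1 n E :=
  ⟨fun ⟨h₁, _, h₂, h₃, h₄⟩ => ⟨h₁, h₂, h₃, h₄⟩,
    fun h => ⟨h.bounds, h.card_eq hn, h.conn, h.noncross, h.alt⟩⟩

/-- Translating a graph by `k` preserves being connected, non-crossing and alternating. -/
lemma isNCAOn_shift_iff {a b k : ℕ} {E F : Finset (ℕ × ℕ)}
    (hEF : ∀ p q, (p + k, q + k) ∈ F ↔ (p, q) ∈ E) (hF : ∀ e ∈ F, k ≤ e.1 ∧ k ≤ e.2) :
    IsNCAOn (a + k) (b + k) F ↔ IsNCAOn a b E := by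
  have hFE : ∀ p q, (p, q) ∈ F → k ≤ p ∧ k ≤ q ∧ (p - k, q - k) ∈ E := by
    intro p q h
    have h' := hF _ h
    refine ⟨h'.1, h'.2, (hEF _ _).1 ?_⟩
    simpa [h'.1, h'.2] using h
  constructor
  · intro h
    refine ⟨fun ⟨p, q⟩ he => ?_, fun v w hv hv' hw hw' => ?_,
      fun ⟨p, q⟩ he ⟨p', q'⟩ he' hc => ?_, fun i v m h₁ h₂ => ?_⟩
    · have := h.bounds _ ((hEF _ _).2 he)
      simp only at this ⊢
      omega
    · simpa using reflTransGen_adjRel_map (F := E) (fun t => t - k)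
        (fun p q hpq => Or.inr (hFE p q hpq).2.2)
        (h.conn (v + k) (w + k) (by omega) (by omega) (by omega) (by omega))
    · refine h.noncross _ ((hEF _ _).2 he) _ ((hEF _ _).2 he') ?_
      simp only at hc ⊢
      omega
    · exact h.alt _ _ _ ((hEF _ _).2 h₁) ((hEF _ _).2 h₂)
  · intro h
    refine ⟨fun ⟨p, q⟩ he => ?_, fun v w hv hv' hw hw' => ?_,
      fun ⟨p, q⟩ he ⟨p', q'⟩ he' hc => ?_, fun i v m h₁ h₂ => ?_⟩
    · obtain ⟨hp, hq, he⟩ := hFE _ _ he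
      have := h.bounds _ he
      simp only at this ⊢
      omega
    · have := reflTransGen_adjRel_map (F := F) (fun t => t + k)
        (fun p q hpq => Or.inr ((hEF p q).2 hpq))
        (h.conn (v - k) (w - k) (by omega) (by omega) (by omega) (by omega))
      simpa [show k ≤ v by omega, show k ≤ w by omega] using this
    · obtain ⟨hp, hq, he⟩ := hFE _ _ he
      obtain ⟨hp', hq', he'⟩ := hFE _ _ he'
      refine h.noncross _ he _ he' ?_
      simp only at hc ⊢
      omega
    · obtain ⟨_, _, h₁⟩ := hFE _ _ h₁
      obtain ⟨_, _, h₂⟩ := hFE _ _ h₂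
      exact h.alt _ _ _ h₁ h₂

/-- The set of non-crossing alternating trees on `{a, ..., b}`. -/
noncomputable def treesOn (a b : ℕ) : Finset (Finset (ℕ × ℕ)) :=
  ((Icc a b ×ˢ Icc a b).powerset).filter (IsNCAOn a b)

lemma mem_treesOn {a b : ℕ} {E : Finset (ℕ × ℕ)} : E ∈ treesOn a b ↔ IsNCAOn a b E := by
  rw [treesOn, mem_filter, mem_powerset, and_iff_right_iff_imp]
  intro h e he
  have := h.bounds e he
  rw [mem_product, mem_Icc, mem_Icc]
  omega

/-- The signed indicator that the vertex `v` of `E` satisfies its colour constraint. -/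
noncomputable def vertexWeight (u₀ : ℝ) (x : ℕ → ℝ) (E : Finset (ℕ × ℕ)) (v : ℕ) : ℝ :=
  if ∃ i, (i, v) ∈ E then (if u₀ < x v then 1 else 0) else (if x v ≤ u₀ then -1 else 0)

/-- The factor contributed by an edge. -/
noncomputable def edgeWeight (x : ℕ → ℝ) (e : ℕ × ℕ) : ℝ :=
  1 / (x e.2 - x e.1 + ((e.2 : ℝ) - (e.1 : ℝ)))

/-- The signed weight of a tree on `{a, ..., b}`, zero if a colour constraint is violated. -/
noncomputable def treeWeight (u₀ : ℝ) (x : ℕ → ℝ) (a b : ℕ) (E : Finset (ℕ × ℕ)) : ℝ :=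
  (∏ v ∈ Icc a b, vertexWeight u₀ x E v) * ∏ e ∈ E, edgeWeight x e

/-- The sum of the weights of all non-crossing alternating trees on `{a, ..., b}`. -/
noncomputable def treeSum (u₀ : ℝ) (x : ℕ → ℝ) (a b : ℕ) : ℝ :=
  ∑ E ∈ treesOn a b, treeWeight u₀ x a b E

lemma vertexWeight_congr {u₀ : ℝ} {x y : ℕ → ℝ} {E F : Finset (ℕ × ℕ)} {v w : ℕ}
    (h : (∃ i, (i, v) ∈ E) ↔ ∃ i, (i, w) ∈ F) (hxy : x v = y w) :
    vertexWeight u₀ x E v = vertexWeight u₀ y F w := by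
  simp only [vertexWeight, h, hxy]

lemma TFun_eq_treeSum (u₀ : ℝ) {n : ℕ} (hn : 1 ≤ n) (x : ℕ → ℝ) :
    TFun u₀ n x = treeSum u₀ x 1 n := by
  rw [TFun, treeSum, treesOn, sum_filter, sum_filter]
  refine sum_congr rfl fun E _ => ?_
  simp only [isNCATree_iff hn]
  by_cases hE : IsNCAOn 1 n E
  swap
  · simp [hE]
  simp only [hE, true_and, if_true, treeWeight]
  split_ifs with hc
  · obtain ⟨hb, hw⟩ := hc
    have : ∏ v ∈ Icc 1 n, vertexWeight u₀ x E v =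
        ∏ v ∈ Icc 1 n, if ∀ i, (i, v) ∉ E then (-1 : ℝ) else 1 := by
      refine prod_congr rfl fun v hv => ?_
      by_cases hblack : ∀ i, (i, v) ∉ E
      · have := hb v (mem_filter.2 ⟨hv, hblack⟩)
        simp [vertexWeight, hblack, this]
      · have := hw v hv fun h => hblack (mem_filter.1 h).2
        rw [vertexWeight, if_pos (by simpa using hblack), if_pos this, if_neg hblack]
    rw [this, ← prod_filter, prod_const]
    rfl
  · symm
    have : ∃ v ∈ Icc 1 n, vertexWeight u₀ x E v = 0 := by
      by_contra! hne
      refine hc ⟨fun v hv => ?_, fun v hv hvb => ?_⟩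
      · obtain ⟨hv, hblack⟩ := mem_filter.1 hv
        by_contra hlt
        exact hne v hv (by simp [vertexWeight, hblack, hlt])
      · by_contra hlt
        refine hne v hv ?_
        have : ∃ i, (i, v) ∈ E := by
          by_contra! h
          exact hvb (mem_filter.2 ⟨hv, h⟩)
        rw [vertexWeight, if_pos this, if_neg hlt]
    obtain ⟨v, hv, hv0⟩ := this
    rw [prod_eq_zero hv hv0, zero_mul]

lemma treeSum_shift (u₀ : ℝ) (x : ℕ → ℝ) (a b k : ℕ) :
    treeSum u₀ (fun t => x (t + k)) a b = treeSum u₀ x (a + k) (b + k) := by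
  let f : ℕ × ℕ → ℕ × ℕ := fun e => (e.1 + k, e.2 + k)
  let g : ℕ × ℕ → ℕ × ℕ := fun e => (e.1 - k, e.2 - k)
  have hf : Function.Injective f := by
    rintro ⟨p, q⟩ ⟨p', q'⟩ h
    simpa [f] using h
  have hgf : ∀ E : Finset (ℕ × ℕ), (E.image f).image g = E := by
    intro E
    rw [image_image]
    refine (image_congr (g := id) fun e _ => ?_).trans image_id
    ext <;> simp [f, g]
  have hfg : ∀ F : Finset (ℕ × ℕ), (∀ e ∈ F, k ≤ e.1 ∧ k ≤ e.2) → (F.image g).image f = F := by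
    intro F hF
    rw [image_image]
    refine (image_congr (g := id) fun e he => ?_).trans image_id
    have := hF e he
    ext <;> simp [f, g, this]
  have hmem : ∀ (E : Finset (ℕ × ℕ)) (p q : ℕ), (p + k, q + k) ∈ E.image f ↔ (p, q) ∈ E :=
    fun E p q => hf.mem_finset_image (a := (p, q))
  have hge : ∀ E : Finset (ℕ × ℕ), ∀ e ∈ E.image f, k ≤ e.1 ∧ k ≤ e.2 := by
    intro E e he
    obtain ⟨e, _, rfl⟩ := mem_image.1 he
    simp [f]
  have hbd : ∀ F ∈ treesOn (a + k) (b + k), ∀ e ∈ F, k ≤ e.1 ∧ k ≤ e.2 := by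
    intro F hF e he
    have := (mem_treesOn.1 hF).bounds e he
    omega
  refine sum_nbij' (fun E => E.image f) (fun F => F.image g) ?_ ?_ ?_ ?_ ?_
  · intro E hE
    rw [mem_treesOn] at hE ⊢
    exact (isNCAOn_shift_iff (hmem E) (hge E)).2 hE
  · intro F hF
    have hF' := mem_treesOn.1 hF
    rw [← hfg F (hbd F hF)] at hF'
    rw [mem_treesOn]
    exact (isNCAOn_shift_iff (hmem _) (hge _)).1 hF'
  · exact fun E _ => hgf E
  · exact fun F hF => hfg F (hbd F hF)
  · intro E _
    rw [treeWeight, treeWeight, prod_image hf.injOn, ← image_add_right_Icc,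
      prod_image (add_left_injective k).injOn]
    congr 1
    · refine prod_congr rfl fun v _ => vertexWeight_congr ⟨?_, ?_⟩ rfl
      · rintro ⟨i, hi⟩
        exact ⟨i + k, (hmem E i v).2 hi⟩
      · rintro ⟨i, hi⟩
        obtain ⟨i, rfl⟩ := Nat.exists_eq_add_of_le' (hge E _ hi).1
        exact ⟨i, (hmem E i v).1 hi⟩
    · refine prod_congr rfl fun e _ => ?_
      simp only [edgeWeight, f]
      push_cast
      congr 2
      ring

lemma treeSum_eq_sum_glue (u₀ : ℝ) (x : ℕ → ℝ) {a b : ℕ} (hab : a < b) :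
    treeSum u₀ x a b = ∑ m ∈ Ico a b, ∑ L ∈ treesOn a m, ∑ R ∈ treesOn (m + 1) b,
      treeWeight u₀ x a b (insert (a, b) (L ∪ R)) := by
  simp only [← sum_product' (treesOn a _) (treesOn (_ + 1) b)
    (fun L R => treeWeight u₀ x a b (insert (a, b) (L ∪ R)))]
  rw [sum_sigma']
  symm
  refine sum_bij (fun t _ => insert (a, b) (t.2.1 ∪ t.2.2)) ?_ ?_ ?_ (fun _ _ => rfl)
  · rintro ⟨m, L, R⟩ h
    simp only [mem_sigma, mem_Ico, mem_product, mem_treesOn] at h ⊢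
    exact h.2.1.glue h.2.2 h.1.1 h.1.2
  · rintro ⟨m, L, R⟩ h ⟨m', L', R'⟩ h' heq
    simp only [mem_sigma, mem_Ico, mem_product, mem_treesOn] at h h' heq
    obtain ⟨⟨ham, hmb⟩, hL, hR⟩ := h
    obtain ⟨⟨ham', hmb'⟩, hL', hR'⟩ := h'
    obtain rfl : m = m' := le_antisymm (hL'.cut_le_of_glue_eq hR' hL ham' ham hmb heq.symm)
      (hL.cut_le_of_glue_eq hR hL' ham ham' hmb' heq)
    have h₁ : L = L' := by
      rw [← hL.filter_le_glue hR hmb, heq, hL'.filter_le_glue hR' hmb]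
    have h₂ : R = R' := by
      rw [← hL.filter_lt_glue hR ham, heq, hL'.filter_lt_glue hR' ham]
    rw [h₁, h₂]
  · intro E hE
    rw [mem_treesOn] at hE
    obtain ⟨m, ham, hmb, hs⟩ := hE.exists_split hab
    refine ⟨⟨m, E.filter (fun e => e.2 ≤ m), E.filter (fun e => m < e.1)⟩, ?_,
      hE.eq_insert_union hab hs⟩
    simp only [mem_sigma, mem_Ico, mem_product, mem_treesOn]
    exact ⟨⟨ham, hmb⟩, hE.left ham hmb hs, hE.right ham hmb hs⟩

/-- The weight of a glued tree, with the weights of the vertices `m + 1, ..., b` kept apart. -/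
lemma treeWeight_glue (u₀ : ℝ) (x : ℕ → ℝ) {a b m : ℕ} {L R : Finset (ℕ × ℕ)}
    (hL : IsNCAOn a m L) (hR : IsNCAOn (m + 1) b R) (ham : a ≤ m) (hmb : m < b) :
    treeWeight u₀ x a b (insert (a, b) (L ∪ R)) =
      treeWeight u₀ x a m L *
        ((∏ v ∈ Icc (m + 1) b, vertexWeight u₀ x (insert (a, b) (L ∪ R)) v) *
          ∏ e ∈ R, edgeWeight x e) * edgeWeight x (a, b) := by
  have hIcc : Icc a b = Icc a m ∪ Icc (m + 1) b := by
    ext v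
    simp only [mem_union, mem_Icc]
    omega
  have hdisj : Disjoint (Icc a m) (Icc (m + 1) b) := by
    rw [Finset.disjoint_left]
    intro v h₁ h₂
    rw [mem_Icc] at h₁ h₂
    omega
  have hleft : ∏ v ∈ Icc a m, vertexWeight u₀ x (insert (a, b) (L ∪ R)) v =
      ∏ v ∈ Icc a m, vertexWeight u₀ x L v := by
    refine prod_congr rfl fun v hv => vertexWeight_congr (exists_congr fun i => ?_) rfl
    rw [mem_Icc] at hv
    simp only [mem_insert, mem_union, Prod.mk.injEq]
    constructor
    · rintro (h | h | h)
      · omega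
      · exact h
      · have := hR.bounds _ h
        simp only at this
        omega
    · exact fun h => Or.inr (Or.inl h)
  rw [treeWeight, treeWeight, hIcc, prod_union hdisj, hleft,
    prod_insert (IsNCAOn.top_notMem_union hL hR ham hmb),
    prod_union (IsNCAOn.disjoint_left_right hL hR)]
  ring

lemma treeWeight_glue_of_lt (u₀ : ℝ) (x : ℕ → ℝ) {a b m : ℕ} {L R : Finset (ℕ × ℕ)}
    (hL : IsNCAOn a m L) (hR : IsNCAOn (m + 1) b R) (ham : a ≤ m) (hmb : m + 1 < b) :
    treeWeight u₀ x a b (insert (a, b) (L ∪ R)) =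
      treeWeight u₀ x a m L * treeWeight u₀ x (m + 1) b R * edgeWeight x (a, b) := by
  rw [treeWeight_glue u₀ x hL hR ham (by omega), treeWeight.eq_def u₀ x (m + 1) b]
  congr 3
  refine prod_congr rfl fun v hv => vertexWeight_congr ?_ rfl
  rw [mem_Icc] at hv
  constructor
  · rintro ⟨i, hi⟩
    simp only [mem_insert, mem_union, Prod.mk.injEq] at hi
    rcases hi with ⟨rfl, rfl⟩ | h | h
    · exact ⟨m + 1, hR.top_mem hmb⟩
    · have := hL.bounds _ h
      simp only at this
      omega
    · exact ⟨i, h⟩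
  · rintro ⟨i, hi⟩
    exact ⟨i, by simp [hi]⟩

lemma treesOn_self (a : ℕ) : treesOn a a = {∅} := by
  ext E
  rw [mem_treesOn, mem_singleton]
  constructor
  · exact fun h => card_eq_zero.1 ((h.card_eq le_rfl).trans (Nat.sub_self a))
  · rintro rfl
    refine ⟨by simp, fun v w hv hv' hw hw' => ?_, by simp, by simp⟩
    rw [show v = w by omega]

lemma treeWeight_glue_top {u₀ : ℝ} {x : ℕ → ℝ} {a m : ℕ} {L : Finset (ℕ × ℕ)}
    (hL : IsNCAOn a m L) (ham : a ≤ m) (hx : u₀ < x (m + 1)) :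
    treeWeight u₀ x a (m + 1) (insert (a, m + 1) (L ∪ ∅)) =
      treeWeight u₀ x a m L * edgeWeight x (a, m + 1) := by
  have hR : IsNCAOn (m + 1) (m + 1) ∅ := mem_treesOn.1 (by simp [treesOn_self])
  rw [treeWeight_glue u₀ x hL hR ham m.lt_succ_self]
  have : ∃ i, (i, m + 1) ∈ insert (a, m + 1) (L ∪ ∅) := ⟨a, mem_insert_self _ _⟩
  rw [Icc_self, prod_singleton, vertexWeight, if_pos this, if_pos hx]
  simp

lemma treeSum_eq_zero {u₀ : ℝ} {x : ℕ → ℝ} {a b : ℕ} (hab : a < b) (hx : x b ≤ u₀) :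
    treeSum u₀ x a b = 0 := by
  refine sum_eq_zero fun E hE => ?_
  have : ∃ i, (i, b) ∈ E := ⟨a, (mem_treesOn.1 hE).top_mem hab⟩
  rw [treeWeight, prod_eq_zero (right_mem_Icc.2 hab.le), zero_mul]
  rw [vertexWeight, if_pos this, if_neg hx.not_gt]

lemma treeSum_succ {u₀ : ℝ} {x : ℕ → ℝ} {a b : ℕ} (hab : a ≤ b) (hx : u₀ < x (b + 1)) :
    treeSum u₀ x a (b + 1) =
      (∑ m ∈ Ico a b, treeSum u₀ x a m * treeSum u₀ x (m + 1) (b + 1) + treeSum u₀ x a b) *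
        edgeWeight x (a, b + 1) := by
  rw [treeSum_eq_sum_glue u₀ x (Nat.lt_succ_of_le hab), sum_Ico_succ_top hab, add_mul, sum_mul]
  congr 1
  · refine sum_congr rfl fun m hm => ?_
    rw [mem_Ico] at hm
    rw [treeSum, treeSum, sum_mul_sum, sum_mul]
    refine sum_congr rfl fun L hL => ?_
    rw [sum_mul]
    exact sum_congr rfl fun R hR => treeWeight_glue_of_lt u₀ x (mem_treesOn.1 hL)
      (mem_treesOn.1 hR) hm.1 (by omega)
  · rw [treeSum, sum_mul, treesOn_self]
    refine sum_congr rfl fun L hL => ?_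
    rw [sum_singleton, treeWeight_glue_top (mem_treesOn.1 hL) hab hx]

/-- If `x_n ≤ u₀` then `𝔗_n(x_1, ..., x_n) = 0`, and if `x_n > u₀` then
`𝔗_n` satisfies the splitting recurrence. -/
theorem TFun_zero_and_recurrence (u₀ : ℝ) (n : ℕ) (hn : 2 ≤ n) (x : ℕ → ℝ)
    (hx : ∀ i m : ℕ, 1 ≤ i → i < m → m ≤ n →
      x m - x i + ((m : ℝ) - (i : ℝ)) ≠ 0) :
    (x n ≤ u₀ → TFun u₀ n x = 0) ∧
    (u₀ < x n → TFun u₀ n x =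
      ((∑ i ∈ Finset.Icc 2 (n - 1),
          TFun u₀ (i - 1) x * TFun u₀ (n - i + 1) (fun t => x (t + i - 1))) +
        TFun u₀ (n - 1) x) / (x n - x 1 + ((n : ℝ) - 1))) := by
  refine ⟨fun h => ?_, fun h => ?_⟩
  · rw [TFun_eq_treeSum u₀ (by omega), treeSum_eq_zero hn h]
  · obtain ⟨k, rfl⟩ : ∃ k, n = k + 1 := ⟨n - 1, by omega⟩
    rw [TFun_eq_treeSum u₀ (by omega), Nat.add_sub_cancel, TFun_eq_treeSum u₀ (by omega),
      treeSum_succ (by omega) h, edgeWeight, Nat.cast_one, mul_one_div]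
    congr 2
    have hIcc : Icc 2 k = Ico (1 + 1) (k + 1) := by
      ext
      simp only [mem_Icc, mem_Ico]
      omega
    rw [hIcc, ← sum_Ico_add' (fun i => TFun u₀ (i - 1) x *
      TFun u₀ (k + 1 - i + 1) (fun t => x (t + i - 1))) 1 k 1]
    refine sum_congr rfl fun m hm => ?_
    rw [mem_Ico] at hm
    have hshift := treeSum_shift u₀ x 1 (k + 1 - m) m
    rw [show 1 + m = m + 1 by omega, show k + 1 - m + m = k + 1 by omega] at hshift
    rw [TFun_eq_treeSum u₀ (by omega), TFun_eq_treeSum u₀ (by omega), ← hshift,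
      show k + 1 - (m + 1) + 1 = k + 1 - m by omega]
    rfl
end
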